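/- For every τ in the upper half-plane, the derivative of λ ↦ ϑ₁(λ,τ) at λ = 0 equals 2π η(τ)³, i.e. ϑ₁′(0,τ) = 2π η(τ)³. -/

import Mathlib

open Complex

/-- The complex number π. -/
noncomputable def cπ : ℂ := Real.pi

/-- The first Jacobi theta function
`ϑ₁(λ,τ) = 2 q^{1/8} sin(πλ) ∏_{j≥1} (1-q^j e^{2πiλ})(1-q^j e^{-2πiλ})(1-q^j)`, `q = e^{2πiτ}`. -/
noncomputable def JTheta1 (z τ : ℂ) : ℂ :=
  2 * exp (cπ * I * τ / 4) * sin (cπ * z) *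
    ∏' n : ℕ, ((1 - exp (2 * cπ * I * τ) ^ (n + 1) * exp (2 * cπ * I * z)) *
      (1 - exp (2 * cπ * I * τ) ^ (n + 1) * exp (-(2 * cπ * I * z))) *
      (1 - exp (2 * cπ * I * τ) ^ (n + 1)))

/-- The Dedekind eta function `η(τ) = q^{1/24} ∏_{j≥1} (1-q^j)`, `q = e^{2πiτ}`. -/
noncomputable def DEta (τ : ℂ) : ℂ :=
  exp (cπ * I * τ / 12) * ∏' n : ℕ, (1 - exp (2 * cπ * I * τ) ^ (n + 1))

/-- The theta function of level κ:
`θ_{κ,n}(λ,τ) = Σ_{j∈ℤ} exp(2πiκ(j+n/(2κ))²τ + 2πiκ(j+n/(2κ))λ)`. -/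
noncomputable def ThetaKN (κ : ℕ) (n : ℤ) (z τ : ℂ) : ℂ :=
  ∑' j : ℤ, exp (2 * cπ * I * (κ : ℂ) * ((j : ℂ) + (n : ℂ) / (2 * (κ : ℂ))) ^ 2 * τ +
    2 * cπ * I * (κ : ℂ) * ((j : ℂ) + (n : ℂ) / (2 * (κ : ℂ))) * z)

/-- The symmetrization `θ^s_{κ,n}(λ,τ) = θ_{κ,n}(λ,τ) + θ_{κ,n}(-λ,τ)`. -/
noncomputable def ThetaS (κ : ℕ) (n : ℤ) (z τ : ℂ) : ℂ :=
  ThetaKN κ n z τ + ThetaKN κ n (-z) τ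

/-- `ρ(λ,τ) = ϑ₁'(λ,τ)/ϑ₁(λ,τ)` (derivative in the first argument). -/
noncomputable def Rho (z τ : ℂ) : ℂ :=
  deriv (fun w => JTheta1 w τ) z / JTheta1 z τ

/-- `ρ'(λ,τ)`, the derivative of `ρ` in the first argument. -/
noncomputable def Rho' (z τ : ℂ) : ℂ := deriv (fun w => Rho w τ) z

/-- `u` satisfies the KZB heat equation with parameters `κ`, `p` at `(λ,τ)`:
`2πiκ ∂u/∂τ = ∂²u/∂λ² + p(p+1)ρ'(λ,τ)u`. -/
def KZB (κ p : ℕ) (u : ℂ → ℂ → ℂ) (z τ : ℂ) : Prop :=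
  2 * cπ * I * (κ : ℂ) * deriv (fun t => u z t) τ =
    iteratedDeriv 2 (fun w => u w τ) z + (p : ℂ) * ((p : ℂ) + 1) * Rho' z τ * u z τ

lemma aux_mult {q : ℂ} (hq : ‖q‖ < 1) (w : ℂ) :
    Multipliable fun n : ℕ => 1 - q ^ (n + 1) * w := by
  have h := ((summable_nat_add_iff 1).mpr
    (summable_geometric_of_lt_one (norm_nonneg _) hq)).mul_right ‖w‖
  have := multipliable_one_add_of_summable (f := fun n : ℕ => -(q ^ (n + 1) * w))
    (by simpa using h)
  simpa [sub_eq_add_neg] using this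

lemma aux_diff {q : ℂ} (hq : ‖q‖ < 1) :
    DifferentiableOn ℂ (fun w => ∏' n : ℕ, (1 - q ^ (n + 1) * w)) (Metric.ball (0 : ℂ) 2) := by
  have h := ((summable_nat_add_iff 1).mpr
    (summable_geometric_of_lt_one (norm_nonneg _) hq)).mul_right (2 : ℝ)
  have h2 := h.hasProdLocallyUniformlyOn_nat_one_add
    (f := fun (n : ℕ) (w : ℂ) => -(q ^ (n + 1) * w)) (K := Metric.ball (0 : ℂ) 2)
    Metric.isOpen_ball (.of_forall fun n w hw => by
      simp only [Metric.mem_ball, dist_zero_right] at hw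
      simp only [norm_neg, norm_mul, norm_pow]
      gcongr) (fun _ => by fun_prop)
  simp only [← sub_eq_add_neg] at h2
  exact h2.differentiableOn
    (.of_forall fun _ ↦ by simpa [Finset.prod_fn] using
      DifferentiableOn.finsetProd (fun _ _ ↦ by fun_prop)) Metric.isOpen_ball

/-- For every `τ` in the upper half-plane, `ϑ₁'(0,τ) = 2π η(τ)³`. -/
theorem jtheta1_deriv_zero (τ : ℂ) (hτ : 0 < τ.im) :
    deriv (fun z => JTheta1 z τ) 0 = 2 * cπ * (DEta τ) ^ 3 := by
  have hq : ‖exp (2 * cπ * I * τ)‖ < 1 := by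
    simpa [cπ] using UpperHalfPlane.norm_exp_two_pi_I_lt_one ⟨τ, hτ⟩
  unfold JTheta1 DEta
  generalize exp (2 * cπ * I * τ) = q at hq ⊢
  have hG := aux_diff hq
  have hm := aux_mult hq
  have hm1 : Multipliable fun n : ℕ => 1 - q ^ (n + 1) := by simpa using hm 1
  have hP : ∀ z : ℂ, ∏' n : ℕ, ((1 - q ^ (n + 1) * exp (2 * cπ * I * z)) *
      (1 - q ^ (n + 1) * exp (-(2 * cπ * I * z))) * (1 - q ^ (n + 1))) =
      (∏' n : ℕ, (1 - q ^ (n + 1) * exp (2 * cπ * I * z))) *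
      (∏' n : ℕ, (1 - q ^ (n + 1) * exp (-(2 * cπ * I * z)))) *
      ∏' n : ℕ, (1 - q ^ (n + 1)) := by
    intro z
    rw [((hm _).mul (hm _)).tprod_mul hm1, (hm _).tprod_mul (hm _)]
  simp only [hP]
  have hE : exp (cπ * I * τ / 4) = exp (cπ * I * τ / 12) ^ 3 := by
    rw [← Complex.exp_nat_mul]; congr 1; push_cast; ring
  have hG1 : ∀ w : ℂ, w = 1 → DifferentiableAt ℂ
      (fun w => ∏' n : ℕ, (1 - q ^ (n + 1) * w)) w := by
    rintro w rfl
    exact hG.differentiableAt (Metric.isOpen_ball.mem_nhds (by simp))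
  have hA : DifferentiableAt ℂ
      (fun z => ∏' n : ℕ, (1 - q ^ (n + 1) * exp (2 * cπ * I * z))) 0 :=
    (hG1 (exp (2 * cπ * I * 0)) (by simp)).comp (0 : ℂ)
      (f := fun z : ℂ => exp (2 * cπ * I * z)) (by fun_prop)
  have hB : DifferentiableAt ℂ
      (fun z => ∏' n : ℕ, (1 - q ^ (n + 1) * exp (-(2 * cπ * I * z)))) 0 :=
    (hG1 (exp (-(2 * cπ * I * 0))) (by simp)).comp (0 : ℂ)
      (f := fun z : ℂ => exp (-(2 * cπ * I * z))) (by fun_prop)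
  have hS : HasDerivAt (fun z : ℂ => 2 * exp (cπ * I * τ / 4) * sin (cπ * z))
      (2 * exp (cπ * I * τ / 4) * (cos (cπ * 0) * (cπ * 1))) 0 :=
    (((hasDerivAt_id (0 : ℂ)).const_mul cπ).csin).const_mul _
  have := (hS.mul ((hA.mul hB).mul_const (∏' n : ℕ, (1 - q ^ (n + 1)))).hasDerivAt).deriv
  refine this.trans ?_
  simp [hE]
  ring
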